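/- Let E = (E⁺,E⁻) be an example set. Let S be the set of all D ∈ E⁻ such that the example set (E⁺,{D}) has a unique most general separator in 𝒬_p[◇], and for D ∈ S let q_D denote this separator. Then E has a unique most general separator in 𝒬[◇] if and only if the query q = ⋀_{D ∈ S} q_D separates E; and in that case q is the unique most general separator of E in 𝒬[◇]. -/

import Mathlib

/-- Atoms are natural numbers (a countably infinite supply). -/
abbrev Atom : Type := ℕ

/-- A (temporal) data instance: a finite set of facts `(A, ℓ)`, i.e. `A(ℓ)`. -/
abbrev Inst : Type := Finset (Atom × ℕ)

/-- LTL queries built from atoms and ⊤ using ∧, ○ (next) and ◇ (strict eventually). -/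
inductive Query : Type where
  | top : Query
  | atom : Atom → Query
  | and : Query → Query → Query
  | next : Query → Query
  | evtl : Query → Query
  deriving DecidableEq

/-- Strict semantics: `Query.sat D q m` says `D, m ⊨ q`. -/
def Query.sat (D : Inst) : Query → ℕ → Prop
  | .top, _ => True
  | .atom a, m => (a, m) ∈ D
  | .and q₁ q₂, m => Query.sat D q₁ m ∧ Query.sat D q₂ m
  | .next q, m => Query.sat D q (m + 1)
  | .evtl q, m => ∃ m', m < m' ∧ Query.sat D q m'

/-- `q ⊨ q'`: every (nonempty) data instance satisfying `q` at 0 satisfies `q'` at 0. -/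
def Entails (q q' : Query) : Prop :=
  ∀ D : Inst, D.Nonempty → Query.sat D q 0 → Query.sat D q' 0

/-- `q ≡ q'`. -/
def QEquiv (q q' : Query) : Prop := Entails q q' ∧ Entails q' q

/-- Temporal operators ○ (next) and ◇ (eventually). -/
inductive TOp : Type where
  | next : TOp
  | evtl : TOp
  deriving DecidableEq

def TOp.apply : TOp → Query → Query
  | .next, q => Query.next q
  | .evtl, q => Query.evtl q

/-- Conjunction of a finite set of atoms (the empty set standing for ⊤). -/
noncomputable def conjQ (ρ : Finset Atom) : Query :=
  ρ.toList.foldr (fun a q => Query.and (Query.atom a) q) Query.top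

/-- `pathFrom ρ o i k` is the path query `ρᵢ ∧ o_{i+1}(ρ_{i+1} ∧ ⋯ ∧ o_{i+k} ρ_{i+k})`. -/
noncomputable def pathFrom (ρ : ℕ → Finset Atom) (o : ℕ → TOp) : ℕ → ℕ → Query
  | i, 0 => conjQ (ρ i)
  | i, k + 1 => Query.and (conjQ (ρ i)) ((o (i + 1)).apply (pathFrom ρ o (i + 1) k))

/-- The path ○◇-query `ρ₀ ∧ o₁(ρ₁ ∧ ⋯ ∧ oₙ ρₙ)`. -/
noncomputable def pathQ (n : ℕ) (ρ : ℕ → Finset Atom) (o : ℕ → TOp) : Query := pathFrom ρ o 0 n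

/-- `q` separates the example set `(E⁺, E⁻)`. -/
def Separates (Ep En : Finset Inst) (q : Query) : Prop :=
  (∀ D ∈ Ep, Query.sat D q 0) ∧ ∀ D ∈ En, ¬ Query.sat D q 0

/-- `q` contains no occurrence of ○. -/
def Query.noNext : Query → Prop
  | .top => True
  | .atom _ => True
  | .and q₁ q₂ => q₁.noNext ∧ q₂.noNext
  | .next _ => False
  | .evtl q => q.noNext

/-- `𝒬[◇]`: all queries built from atoms and ⊤ using ∧ and ◇. -/
def QDall : Set Query := {q | q.noNext}

/-- `𝒬_p[◇]`: all path ◇-queries. -/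
def Qpdall : Set Query :=
  {q | ∃ (n : ℕ) (ρ : ℕ → Finset Atom), q = pathQ n ρ fun _ => TOp.evtl}

/-- Conjunction of a list of queries (empty conjunction = ⊤). -/
noncomputable def bigAnd : List Query → Query
  | [] => Query.top
  | q :: qs => Query.and q (bigAnd qs)

/-- `q` is a unique most general `Q`-separator of `(E⁺, E⁻)`: a separator in `Q`
entailed by every separator in `Q`. -/
def UniqueMostGeneral (Ep En : Finset Inst) (Q : Set Query) (q : Query) : Prop :=
  q ∈ Q ∧ Separates Ep En q ∧ ∀ q' ∈ Q, Separates Ep En q' → Entails q' q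

/-- `D, m` satisfies the tail `◇(c₁ ∧ ◇(c₂ ∧ ⋯))` of a path query, given as the word `[c₁, c₂, …]`. -/
def WordSat (D : Inst) : List (Finset Atom) → ℕ → Prop
  | [], _ => True
  | c :: w, m => ∃ m', m < m' ∧ (∀ a ∈ c, (a, m') ∈ D) ∧ WordSat D w m'

/-- The atoms that hold in `D` at time `m`. -/
def Finset.atomsAt (D : Inst) (m : ℕ) : Finset Atom := (D.filter (·.2 = m)).image Prod.fst

/-- The word `w` embeds into the word `x`, the latter being continued by empty letters. -/
def WordEmb : List (Finset Atom) → List (Finset Atom) → Prop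
  | [], _ => True
  | c :: w, [] => c = ∅ ∧ WordEmb w []
  | c :: w, a :: x => (c ⊆ a ∧ WordEmb w x) ∨ WordEmb (c :: w) x
termination_by w x => (w.length, x.length)

/-- An atomic query, or a path query with empty first letter. -/
def BasicSat (D : Inst) : Atom ⊕ List (Finset Atom) → ℕ → Prop
  | .inl a, m => (a, m) ∈ D
  | .inr w, m => WordSat D w m

theorem mem_atomsAt {D : Inst} {m : ℕ} {a : Atom} : a ∈ D.atomsAt m ↔ (a, m) ∈ D := by
  simp [Finset.atomsAt]

theorem WordSat.antitone {D : Inst} {w : List (Finset Atom)} {m m' : ℕ} (h : WordSat D w m')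
    (hm : m ≤ m') : WordSat D w m := by
  cases w with
  | nil => trivial
  | cons c w =>
    obtain ⟨k, hk, h⟩ := h
    exact ⟨k, by omega, h⟩

theorem WordSat.mono {D D' : Inst} (hD : D ⊆ D') {w : List (Finset Atom)} {m : ℕ}
    (h : WordSat D w m) : WordSat D' w m := by
  induction w generalizing m with
  | nil => trivial
  | cons c w ih =>
    obtain ⟨k, hk, hc, h⟩ := h
    exact ⟨k, hk, fun a ha => hD (hc a ha), ih h⟩

namespace WordEmb

variable {w x y : List (Finset Atom)} {a b c : Finset Atom}

theorem tail (h : WordEmb (c :: w) x) : WordEmb w x := by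
  induction x generalizing c w with
  | nil => rw [WordEmb] at h; exact h.2
  | cons a x ih =>
    cases w with
    | nil => rw [WordEmb]; trivial
    | cons d w =>
      rw [WordEmb] at h ⊢
      rcases h with h | h
      · exact .inr h.2
      · exact .inr (ih h)

theorem cons (h : WordEmb w x) : WordEmb w (a :: x) := by
  cases w with
  | nil => rw [WordEmb]; trivial
  | cons c w => rw [WordEmb]; exact .inr h

theorem of_nil (h : WordEmb w []) : WordEmb w x := by
  induction x with
  | nil => exact h
  | cons a x ih => exact ih.cons

theorem cons_mono (hxy : ∀ u, WordEmb u x → WordEmb u y) (hab : a ⊆ b)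
    (h : WordEmb w (a :: x)) : WordEmb w (b :: y) := by
  cases w with
  | nil => rw [WordEmb]; trivial
  | cons c w =>
    rw [WordEmb] at h ⊢
    exact h.imp (fun h => ⟨h.1.trans hab, hxy _ h.2⟩) (hxy _)

theorem exists_merge (x y w : List (Finset Atom)) (hx : ¬ WordEmb w x) (hy : ¬ WordEmb w y) :
    ∃ z, ¬ WordEmb w z ∧ (∀ u, WordEmb u x → WordEmb u z) ∧ ∀ u, WordEmb u y → WordEmb u z := by
  match x, y, w with
  | x, y, [] => exact absurd (by rw [WordEmb]; trivial) hx
  | [], y, _ => exact ⟨y, hy, fun _ => of_nil, fun _ => id⟩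
  | x, [], _ => exact ⟨x, hx, fun _ => id, fun _ => of_nil⟩
  | a :: x, b :: y, c :: w =>
    by_cases ha : c ⊆ a
    · by_cases hb : c ⊆ b
      · rw [WordEmb] at hx hy
        obtain ⟨z, hz, hxz, hyz⟩ :=
          exists_merge x y w (fun h => hx (.inl ⟨ha, h⟩)) (fun h => hy (.inl ⟨hb, h⟩))
        refine ⟨(a ∪ b) :: z, fun h => ?_, fun u => cons_mono hxz Finset.subset_union_left,
          fun u => cons_mono hyz Finset.subset_union_right⟩
        rw [WordEmb] at h
        exact hz (h.elim And.right tail)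
      · obtain ⟨z, hz, hxz, hyz⟩ := exists_merge (a :: x) y (c :: w) hx (fun h => hy h.cons)
        refine ⟨b :: z, fun h => ?_, fun u h => (hxz u h).cons,
          fun u => cons_mono hyz subset_rfl⟩
        rw [WordEmb] at h
        exact hz (h.resolve_left fun h => hb h.1)
    · obtain ⟨z, hz, hxz, hyz⟩ := exists_merge x (b :: y) (c :: w) (fun h => hx h.cons) hy
      refine ⟨a :: z, fun h => ?_, fun u => cons_mono hxz subset_rfl, fun u h => (hyz u h).cons⟩
      rw [WordEmb] at h
      exact hz (h.resolve_left fun h => ha h.1)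
termination_by x.length + y.length

theorem exists_merge_finset {ι : Type*} {F : Finset ι} (hF : F.Nonempty)
    (x : ι → List (Finset Atom)) (w : List (Finset Atom)) (h : ∀ i ∈ F, ¬ WordEmb w (x i)) :
    ∃ z, ¬ WordEmb w z ∧ ∀ i ∈ F, ∀ u, WordEmb u (x i) → WordEmb u z := by
  induction hF using Finset.Nonempty.cons_induction with
  | singleton i =>
    refine ⟨x i, h i (by simp), fun j hj u hu => ?_⟩
    rwa [Finset.mem_singleton.1 hj] at hu
  | cons i F hi hF ih =>
    obtain ⟨z, hz, hFz⟩ := ih fun j hj => h j (Finset.mem_cons_of_mem hj)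
    obtain ⟨z', hz', hxz, hzz⟩ := exists_merge (x i) z w (h i (Finset.mem_cons_self i F)) hz
    refine ⟨z', hz', fun j hj u hu => ?_⟩
    rcases Finset.mem_cons.1 hj with rfl | hj
    · exact hxz u hu
    · exact hzz u (hFz j hj u hu)

end WordEmb

theorem wordSat_cons_iff {D : Inst} {c : Finset Atom} {w : List (Finset Atom)} {m : ℕ} :
    WordSat D (c :: w) m ↔
      (c ⊆ D.atomsAt (m + 1) ∧ WordSat D w (m + 1)) ∨ WordSat D (c :: w) (m + 1) := by
  constructor
  · rintro ⟨k, hk, hc, h⟩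
    rcases Nat.eq_or_lt_of_le (Nat.succ_le_of_lt hk) with rfl | hk
    · exact .inl ⟨fun a ha => mem_atomsAt.2 (hc a ha), h⟩
    · exact .inr ⟨k, hk, hc, h⟩
  · rintro (⟨hc, h⟩ | h)
    · exact ⟨m + 1, by omega, fun a ha => mem_atomsAt.1 (hc ha), h⟩
    · exact h.antitone (by omega)

theorem wordSat_iff_wordEmb {D : Inst} {x : List (Finset Atom)} {m : ℕ}
    (hx : ∀ i, D.atomsAt (m + 1 + i) = x.getD i ∅) (w : List (Finset Atom)) :
    WordSat D w m ↔ WordEmb w x := by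
  induction x generalizing m w with
  | nil =>
    induction w generalizing m with
    | nil => simp [WordSat, WordEmb]
    | cons c w ih =>
      rw [WordEmb]
      constructor
      · rintro ⟨k, hk, hc, h⟩
        obtain ⟨i, rfl⟩ := Nat.exists_eq_add_of_lt hk
        refine ⟨Finset.eq_empty_of_forall_notMem fun a ha => ?_,
          (ih hx).1 (h.antitone (by omega))⟩
        have := mem_atomsAt.2 (hc a ha)
        rw [show m + i + 1 = m + 1 + i by omega, hx i] at this
        simp at this
      · rintro ⟨rfl, h⟩
        refine ⟨m + 1, by omega, by simp, (ih fun i => ?_).2 h⟩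
        rw [show m + 1 + 1 + i = m + 1 + (i + 1) by omega, hx]
        simp
  | cons a x ih =>
    have hx' : ∀ i, D.atomsAt (m + 1 + 1 + i) = x.getD i ∅ := fun i => by
      rw [show m + 1 + 1 + i = m + 1 + (i + 1) by omega, hx]
      simp
    induction w with
    | nil => simp [WordSat, WordEmb]
    | cons c w =>
      rw [WordEmb, wordSat_cons_iff, ih hx', ih hx']
      have := hx 0
      simp only [add_zero, List.getD_cons_zero] at this
      rw [this]

theorem exists_trace (D : Inst) : ∃ x, ∀ w, WordSat D w 0 ↔ WordEmb w x := by
  obtain ⟨N, hN⟩ : ∃ N, ∀ e ∈ D, e.2 ≤ N := ⟨D.sup Prod.snd, fun e he => Finset.le_sup he⟩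
  refine ⟨(List.range N).map fun i => D.atomsAt (i + 1), wordSat_iff_wordEmb fun i => ?_⟩
  by_cases hi : i < N
  · simp [hi, Nat.add_comm]
  · rw [List.getD_eq_default _ _ (by simpa using hi)]
    refine Finset.eq_empty_of_forall_notMem fun a ha => hi ?_
    have := hN _ (mem_atomsAt.1 ha)
    simp only at this
    omega

theorem exists_inst (ρ : Finset Atom) (x : List (Finset Atom)) :
    ∃ D : Inst, D.atomsAt 0 = ρ ∧ ∀ w, WordSat D w 0 ↔ WordEmb w x := by
  have key : ∀ n, ((Finset.range ((ρ :: x).length)).biUnion fun i =>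
      ((ρ :: x).getD i ∅).image fun a => (a, i)).atomsAt n = (ρ :: x).getD n ∅ := by
    intro n
    ext a
    rw [mem_atomsAt]
    simp only [Finset.mem_biUnion, Finset.mem_image, Finset.mem_range, Prod.mk.injEq]
    constructor
    · rintro ⟨i, -, b, hb, rfl, rfl⟩
      exact hb
    · intro ha
      refine ⟨n, ?_, a, ha, rfl, rfl⟩
      by_contra hn
      rw [List.getD_eq_default _ _ (not_lt.1 hn)] at ha
      simp at ha
  refine ⟨_, (key 0).trans (by simp), wordSat_iff_wordEmb fun i => ?_⟩
  rw [key, Nat.zero_add, Nat.add_comm]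
  simp

theorem sat_conjQ {D : Inst} {ρ : Finset Atom} {m : ℕ} :
    (conjQ ρ).sat D m ↔ ∀ a ∈ ρ, (a, m) ∈ D := by
  have : ∀ l : List Atom, (l.foldr (fun a q => Query.and (Query.atom a) q) Query.top).sat D m ↔
      ∀ a ∈ l, (a, m) ∈ D := by
    intro l
    induction l with
    | nil => simp [Query.sat]
    | cons a l ih => simp [Query.sat, ih]
  simpa [conjQ] using this ρ.toList

theorem noNext_conjQ (ρ : Finset Atom) : (conjQ ρ).noNext := by
  unfold conjQ
  induction ρ.toList with
  | nil => trivial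
  | cons a l ih => exact ⟨trivial, ih⟩

theorem sat_bigAnd {D : Inst} {l : List Query} {m : ℕ} :
    (bigAnd l).sat D m ↔ ∀ q ∈ l, q.sat D m := by
  induction l with
  | nil => simp [bigAnd, Query.sat]
  | cons a l ih => simp [bigAnd, Query.sat, ih]

theorem noNext_bigAnd {l : List Query} (h : ∀ q ∈ l, q.noNext) : (bigAnd l).noNext := by
  induction l with
  | nil => trivial
  | cons a l ih => exact ⟨h a (by simp), ih fun q hq => h q (by simp [hq])⟩

theorem sat_pathFrom {D : Inst} {ρ : ℕ → Finset Atom} {i k m : ℕ} :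
    (pathFrom ρ (fun _ => TOp.evtl) i k).sat D m ↔
      (∀ a ∈ ρ i, (a, m) ∈ D) ∧ WordSat D ((List.range' (i + 1) k).map ρ) m := by
  induction k generalizing i m with
  | zero => simp [pathFrom, sat_conjQ, WordSat]
  | succ k ih => simp [pathFrom, Query.sat, TOp.apply, sat_conjQ, ih, List.range'_succ, WordSat]

theorem noNext_of_mem_Qpdall {q : Query} (hq : q ∈ Qpdall) : q.noNext := by
  obtain ⟨n, ρ, rfl⟩ := hq
  suffices ∀ i, (pathFrom ρ (fun _ => TOp.evtl) i n).noNext from this 0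
  induction n with
  | zero => exact fun i => noNext_conjQ _
  | succ n ih => exact fun i => ⟨noNext_conjQ _, ih (i + 1)⟩

theorem exists_word_of_mem_Qpdall {q : Query} (hq : q ∈ Qpdall) :
    ∃ (ρ : Finset Atom) (w : List (Finset Atom)), ∀ D m,
      q.sat D m ↔ (∀ a ∈ ρ, (a, m) ∈ D) ∧ WordSat D w m := by
  obtain ⟨n, ρ, rfl⟩ := hq
  exact ⟨_, _, fun D m => sat_pathFrom⟩

theorem exists_path_basicSat (b : Atom ⊕ List (Finset Atom)) :
    ∃ q ∈ Qpdall, ∀ D m, q.sat D m ↔ BasicSat D b m := by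
  cases b with
  | inl a =>
    refine ⟨_, ⟨0, fun _ => {a}, rfl⟩, fun D m => ?_⟩
    rw [pathQ, sat_pathFrom]
    simp [WordSat, BasicSat]
  | inr w =>
    refine ⟨_, ⟨w.length, fun i => (∅ :: w).getD i ∅, rfl⟩, fun D m => ?_⟩
    have : (List.range' (0 + 1) w.length).map (fun i => (∅ :: w).getD i ∅) = w := by
      refine List.ext_getElem (by simp) fun i h₁ h₂ => ?_
      simp [Nat.add_comm 1 i, h₂]
    rw [pathQ, sat_pathFrom, this]
    simp [BasicSat]

theorem exists_basic_of_noNext {q : Query} (hq : q.noNext) :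
    ∃ L : List (Atom ⊕ List (Finset Atom)), ∀ D m, q.sat D m ↔ ∀ b ∈ L, BasicSat D b m := by
  induction q with
  | top => exact ⟨[], by simp [Query.sat]⟩
  | atom a => exact ⟨[.inl a], by simp [Query.sat, BasicSat]⟩
  | and p q ihp ihq =>
    obtain ⟨L, hL⟩ := ihp hq.1
    obtain ⟨M, hM⟩ := ihq hq.2
    refine ⟨L ++ M, fun D m => ?_⟩
    simp only [Query.sat, hL, hM, List.forall_mem_append]
  | next q => exact hq.elim
  | evtl q ih =>
    obtain ⟨L, hL⟩ := ih hq
    let ρ : Finset Atom := (L.filterMap Sum.getLeft?).toFinset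
    have hρ : ∀ a, a ∈ ρ ↔ .inl a ∈ L := by simp [ρ]
    refine ⟨([] :: L.filterMap Sum.getRight?).map fun w => .inr (ρ :: w), fun D m => ?_⟩
    simp only [List.forall_mem_map, BasicSat]
    constructor
    · rintro ⟨k, hk, h⟩ w hw
      rw [hL] at h
      refine ⟨k, hk, fun a ha => h _ ((hρ a).1 ha), ?_⟩
      rcases List.mem_cons.1 hw with rfl | hw
      · trivial
      · exact h (.inr w) (by simpa using hw)
    · intro h
      classical
      have hex : ∃ k, m < k ∧ ∀ a ∈ ρ, (a, k) ∈ D := by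
        obtain ⟨k, hk, hc, -⟩ := h [] (by simp)
        exact ⟨k, hk, hc⟩
      refine ⟨Nat.find hex, (Nat.find_spec hex).1, (hL _ _).2 fun b hb => ?_⟩
      cases b with
      | inl a => exact (Nat.find_spec hex).2 a ((hρ a).2 hb)
      | inr w =>
        obtain ⟨k, hk, hc, hw⟩ := h w (by simpa using .inr hb)
        exact hw.antitone (Nat.find_min' hex ⟨hk, hc⟩)

/-- Basic queries are prime: a conjunction of path queries entails one only if some conjunct does. -/
theorem exists_entails_basic {ι : Type*} {F : Finset ι} (hF : F.Nonempty) {p : ι → Query}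
    (hp : ∀ i ∈ F, p i ∈ Qpdall) {b : Atom ⊕ List (Finset Atom)}
    (h : ∀ M : Inst, M.Nonempty → (∀ i ∈ F, (p i).sat M 0) → BasicSat M b 0) :
    ∃ i ∈ F, ∀ M : Inst, M.Nonempty → (p i).sat M 0 → BasicSat M b 0 := by
  by_contra! hcon
  choose! M hMne hMp hMb using hcon
  choose! ρ w hρw using fun i hi => exists_word_of_mem_Qpdall (hp i hi)
  have hMp' := fun i hi => (hρw i hi _ _).1 (hMp i hi)
  cases b with
  | inl a =>
    have hsub : ∀ i ∈ F, M i ⊆ F.biUnion M := fun i hi => Finset.subset_biUnion_of_mem M hi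
    have := h (F.biUnion M) (hF.biUnion hMne) fun i hi => (hρw i hi _ _).2
      ⟨fun a ha => hsub i hi ((hMp' i hi).1 a ha), (hMp' i hi).2.mono (hsub i hi)⟩
    obtain ⟨i, hi, hai⟩ := Finset.mem_biUnion.1 this
    exact hMb i hi hai
  | inr v =>
    choose x hx using fun i => exists_trace (M i)
    obtain ⟨z, hz, hxz⟩ := WordEmb.exists_merge_finset hF x v
      fun i hi hv => hMb i hi ((hx i v).2 hv)
    obtain ⟨N, hN₀, hN⟩ := exists_inst (insert 0 (F.biUnion ρ)) z
    have hmem : ∀ a, a ∈ insert 0 (F.biUnion ρ) → (a, 0) ∈ N := fun a ha =>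
      mem_atomsAt.1 (hN₀ ▸ ha)
    refine hz ((hN v).1 (h N ⟨_, hmem 0 (Finset.mem_insert_self _ _)⟩ fun i hi =>
      (hρw i hi _ _).2 ⟨fun a ha => hmem a (Finset.mem_insert_of_mem
        (Finset.mem_biUnion.2 ⟨i, hi, ha⟩)), ?_⟩))
    exact (hN _).2 (hxz i hi _ ((hx i _).1 (hMp' i hi).2))

/-- If `q` is the most general `𝒬[◇]`-separator, then each negative example refutes a basic
consequence of `q` that is the most general path separator for some negative example. -/
theorem UniqueMostGeneral.exists_basic {Ep En : Finset Inst} {q : Query}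
    (hq : UniqueMostGeneral Ep En QDall q)
    (hn : ∀ D ∈ En, D.Nonempty) {D₀ : Inst} (hD₀ : D₀ ∈ En) :
    ∃ r, ¬ r.sat D₀ 0 ∧ ∃ D ∈ En, UniqueMostGeneral Ep {D} Qpdall r := by
  classical
  obtain ⟨hqQ, hqs, hqg⟩ := hq
  obtain ⟨L, hL⟩ := exists_basic_of_noNext hqQ
  have hfail : ∀ D ∈ En, ∃ b ∈ L, ¬ BasicSat D b 0 := fun D hD => by
    simpa [hL, -Sum.exists, -Sum.forall] using hqs.2 D hD
  have hLp : ∀ b ∈ L, ∀ D ∈ Ep, BasicSat D b 0 := fun b hb D hD => (hL D 0).1 (hqs.1 D hD) b hb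
  obtain ⟨b, hb, hmin⟩ := (L.toFinset.filter fun b => ¬ BasicSat D₀ b 0).exists_min_image
    (fun b => (En.filter fun D => BasicSat D b 0).card) (by
      obtain ⟨b, hb⟩ := hfail D₀ hD₀
      exact ⟨b, by simpa using hb⟩)
  simp only [Finset.mem_filter, List.mem_toFinset, and_imp] at hb hmin
  obtain ⟨r, hrQ, hr⟩ := exists_path_basicSat b
  refine ⟨r, fun h => hb.2 ((hr _ _).1 h), ?_⟩
  by_contra hcon
  have hchoice : ∀ D ∈ En, ∃ p ∈ Qpdall, (∀ P ∈ Ep, p.sat P 0) ∧ ¬ p.sat D 0 ∧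
      ∃ M : Inst, M.Nonempty ∧ p.sat M 0 ∧ ¬ BasicSat M b 0 := by
    intro D hD
    by_cases hDb : BasicSat D b 0
    · obtain ⟨b', hb', hDb'⟩ := hfail D hD
      obtain ⟨p, hpQ, hp'⟩ := exists_path_basicSat b'
      refine ⟨p, hpQ, by simpa [hp'] using hLp b' hb', by simpa [hp'] using hDb', ?_⟩
      by_contra! hent
      refine absurd (hmin b' hb' fun h => hb.2 (hent _ (hn _ hD₀) ((hp' _ _).2 h))) (not_le.2 ?_)
      refine Finset.card_lt_card (Finset.ssubset_iff_of_subset ?_ |>.2 ⟨D, ?_, ?_⟩)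
      · intro K hK
        rw [Finset.mem_filter] at hK ⊢
        exact ⟨hK.1, hent K (hn K hK.1) ((hp' _ _).2 hK.2)⟩
      · simp [hD, hDb]
      · simp [hDb']
    · by_contra! hent
      refine hcon ⟨D, hD, hrQ, ⟨fun P hP => (hr _ _).2 (hLp b hb.1 P hP), ?_⟩, ?_⟩
      · simpa [hr] using hDb
      · intro p hpQ hps M hM hpM
        exact (hr _ _).2 (hent p hpQ hps.1 (hps.2 D (by simp)) M hM hpM)
  have : Nonempty Query := ⟨.top⟩
  choose! p hpQ hpp hpn hpb using hchoice
  obtain ⟨D, hD, hent⟩ := exists_entails_basic ⟨D₀, hD₀⟩ hpQ (b := b) fun M hM hMp => by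
    refine (hL M 0).1 (hqg (bigAnd (En.toList.map p)) ?_ ⟨fun P hP => ?_, fun D hD h => ?_⟩ M hM
      ?_) b hb.1
    · exact noNext_bigAnd (by simpa using fun D hD => noNext_of_mem_Qpdall (hpQ D hD))
    · simpa [sat_bigAnd] using fun D hD => hpp D hD P hP
    · exact hpn D hD (sat_bigAnd.1 h _ (List.mem_map_of_mem (Finset.mem_toList.2 hD)))
    · simpa [sat_bigAnd] using hMp
  obtain ⟨M, hM, hMp, hMb⟩ := hpb D hD
  exact hMb (hent M hM hMp)

/-- Let `S` consist of those `D ∈ E⁻` such that `(E⁺, {D})` has a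
unique most general `𝒬_p[◇]`-separator `q_D = f D`. Then `E` has a unique most general
separator in `𝒬[◇]` iff `q = ⋀_{D ∈ S} q_D` separates `E`; in that case `q` is the
unique most general `𝒬[◇]`-separator of `E`. -/
theorem statement_19 (Ep En : Finset Inst) (hEp : Ep.Nonempty)
    (hp : ∀ D ∈ Ep, D.Nonempty) (hn : ∀ D ∈ En, D.Nonempty)
    (S : Finset Inst)
    (hS : ∀ D, D ∈ S ↔ D ∈ En ∧ ∃ qD, UniqueMostGeneral Ep {D} Qpdall qD)
    (f : Inst → Query)
    (hf : ∀ D ∈ S, UniqueMostGeneral Ep {D} Qpdall (f D)) :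
    ((∃ q, UniqueMostGeneral Ep En QDall q) ↔
        Separates Ep En (bigAnd (S.toList.map f))) ∧
    (Separates Ep En (bigAnd (S.toList.map f)) →
      UniqueMostGeneral Ep En QDall (bigAnd (S.toList.map f))) := by
  have hsat : ∀ D m, (bigAnd (S.toList.map f)).sat D m ↔ ∀ K ∈ S, (f K).sat D m := fun D m => by
    simp [sat_bigAnd]
  have hgen : Separates Ep En (bigAnd (S.toList.map f)) →
      UniqueMostGeneral Ep En QDall (bigAnd (S.toList.map f)) := by
    intro hsep
    refine ⟨noNext_bigAnd (by simpa using fun D hD => noNext_of_mem_Qpdall (hf D hD).1), hsep,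
      fun q hq hqs M hM hqM => (hsat M 0).2 fun K hK => ?_⟩
    obtain ⟨L, hL⟩ := exists_basic_of_noNext hq
    obtain ⟨b, hb, hKb⟩ : ∃ b ∈ L, ¬ BasicSat K b 0 := by
      simpa [hL, -Sum.exists, -Sum.forall] using hqs.2 K ((hS K).1 hK).1
    obtain ⟨p, hpQ, hpb⟩ := exists_path_basicSat b
    refine (hf K hK).2.2 p hpQ ⟨fun P hP => ?_, by simpa [hpb] using hKb⟩ M hM ?_
    · exact (hpb _ _).2 ((hL _ _).1 (hqs.1 P hP) b hb)
    · exact (hpb _ _).2 ((hL _ _).1 hqM b hb)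
  refine ⟨⟨?_, fun h => ⟨_, hgen h⟩⟩, hgen⟩
  rintro ⟨q, hq⟩
  refine ⟨fun P hP => (hsat P 0).2 fun K hK => (hf K hK).2.1.1 P hP, fun D₀ hD₀ h => ?_⟩
  obtain ⟨r, hr, D, hD, hrD⟩ := hq.exists_basic hn hD₀
  have hDS : D ∈ S := (hS D).2 ⟨hD, r, hrD⟩
  exact hr (hrD.2.2 _ (hf D hDS).1 (hf D hDS).2.1 D₀ (hn _ hD₀) ((hsat D₀ 0).1 h D hDS))
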